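/- arXiv:2411.08303 — 2 statements merged into one kernel-verified Lean document; each statement's English description precedes it below -/
import Mathlib

section
/- Let β > 0, δ > 0 and let g : ℝ → ℝ be a thrice continuously differentiable function with bounded first, second and third derivatives. Then for every x ∈ ℝ^{n×m}, Σ_{i₁,i₂,i₃=1}^{n} Σ_{j₁,j₂,j₃=1}^{m} |∂³(g ∘ F^{βδ})(x) / (∂x_{i₁,j₁} ∂x_{i₂,j₂} ∂x_{i₃,j₃})| ≤ ‖g'''‖_∞ + 6β(1+δ)‖g''‖_∞ + 6β²(1+δ)²‖g'‖_∞. -/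
open Real

/-- The smooth min-max approximation `F^{βδ}`. -/
noncomputable def Fbd (β δ : ℝ) {n m : ℕ} (x : Fin n → Fin m → ℝ) : ℝ :=
  -(1 / (β * δ)) * Real.log (∑ i, (∑ j, Real.exp (β * x i j)) ^ (-δ))

theorem iteratedFDeriv_succ_cons_eq_of_hasLineDerivAt {E : Type*} [NormedAddCommGroup E]
    [NormedSpace ℝ E] {k : ℕ} {f h : E → ℝ} (hf : ContDiff ℝ (k + 1) f) {u : Fin k → E}
    (hh : ∀ y, iteratedFDeriv ℝ k f y u = h y) {x v : E} {d : ℝ}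
    (hd : HasLineDerivAt ℝ h d x v) :
    iteratedFDeriv ℝ (k + 1) f x (Matrix.vecCons v u) = d := by
  have h1 : Differentiable ℝ (iteratedFDeriv ℝ k f) :=
    hf.differentiable_iteratedFDeriv (by exact_mod_cast Nat.lt_succ_self k)
  have h2 : HasFDerivAt (fun y => iteratedFDeriv ℝ k f y u)
      ((ContinuousMultilinearMap.apply ℝ (fun _ : Fin k => E) ℝ u).comp
        (fderiv ℝ (iteratedFDeriv ℝ k f) x)) x :=
    (ContinuousMultilinearMap.apply ℝ (fun _ : Fin k => E) ℝ u).hasFDerivAt.comp x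
      (h1 x).hasFDerivAt
  have h3 : (fun y => iteratedFDeriv ℝ k f y u) = h := funext hh
  rw [h3] at h2
  have h4 := (h2.hasLineDerivAt v).unique hd
  rw [iteratedFDeriv_succ_apply_left, ← h4]
  rfl

theorem iteratedFDeriv_three_eq_of_hasLineDerivAt {E : Type*} [NormedAddCommGroup E]
    [NormedSpace ℝ E] {f f₁ f₂ : E → ℝ} (hf : ContDiff ℝ 3 f) {a b c x : E} {d : ℝ}
    (h₁ : ∀ y, HasLineDerivAt ℝ f (f₁ y) y c) (h₂ : ∀ y, HasLineDerivAt ℝ f₁ (f₂ y) y b)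
    (h₃ : HasLineDerivAt ℝ f₂ d x a) :
    iteratedFDeriv ℝ 3 f x ![a, b, c] = d := by
  refine iteratedFDeriv_succ_cons_eq_of_hasLineDerivAt (k := 2) (by norm_num; exact hf)
    (fun y => ?_) h₃
  refine iteratedFDeriv_succ_cons_eq_of_hasLineDerivAt (k := 1)
    (hf.of_le (by norm_num)) (fun y => ?_) (h₂ y)
  exact iteratedFDeriv_succ_cons_eq_of_hasLineDerivAt (k := 0)
    (hf.of_le (by norm_num)) (fun y => iteratedFDeriv_zero_apply _) (h₁ y)

section Weights

variable {n m : ℕ}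

/-- The sum of the exponentials `exp (β x)` over row `i`. -/
noncomputable def expRowSum (β : ℝ) (x : Fin n → Fin m → ℝ) (i : Fin n) : ℝ :=
  ∑ j, exp (β * x i j)

/-- The softmax weight of an entry within its own row. -/
noncomputable def rowWeight (β : ℝ) (x : Fin n → Fin m → ℝ) (A : Fin n × Fin m) : ℝ :=
  exp (β * x A.1 A.2) / expRowSum β x A.1

/-- The partition function of the soft minimum over the rows. -/
noncomputable def partitionSum (β δ : ℝ) (x : Fin n → Fin m → ℝ) : ℝ :=
  ∑ i, expRowSum β x i ^ (-δ)

/-- The weight of an entry, which is the partial derivative of `Fbd` at that entry. -/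
noncomputable def entryWeight (β δ : ℝ) (x : Fin n → Fin m → ℝ) (A : Fin n × Fin m) : ℝ :=
  expRowSum β x A.1 ^ (-δ) / partitionSum β δ x * rowWeight β x A

/-- The indicator that two entries coincide. -/
noncomputable def sameEntry (A B : Fin n × Fin m) : ℝ := if A = B then 1 else 0

/-- The indicator that two entries lie in the same row. -/
noncomputable def sameRow (A B : Fin n × Fin m) : ℝ := if A.1 = B.1 then 1 else 0

/-- The standard basis matrix at the entry `A`. -/
noncomputable def basisMatrix (A : Fin n × Fin m) : Fin n → Fin m → ℝ :=
  Pi.single A.1 (Pi.single A.2 1)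

theorem basisMatrix_apply (A : Fin n × Fin m) (i : Fin n) (j : Fin m) :
    basisMatrix A i j = sameEntry (i, j) A := by
  obtain ⟨k, l⟩ := A
  by_cases hi : i = k
  · subst hi
    by_cases hj : j = l
    · subst hj
      simp [basisMatrix, sameEntry]
    · simp [basisMatrix, sameEntry, hj]
  · simp [basisMatrix, sameEntry, hi]

theorem sum_sameEntry (A : Fin n × Fin m) : ∑ B, sameEntry A B = 1 := by
  simp [sameEntry]

theorem sum_mul_sameEntry (f : Fin m → ℝ) (i : Fin n) (C : Fin n × Fin m) (j : Fin m) :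
    ∑ l, f l * sameEntry (i, l) C = sameRow (i, j) C * f C.2 := by
  obtain ⟨k, l⟩ := C
  by_cases hi : i = k <;> simp [sameEntry, sameRow, hi]

theorem sum_mul_sameRow (f : Fin n → ℝ) (j : Fin m) (C : Fin n × Fin m) :
    ∑ i, f i * sameRow (i, j) C = f C.1 := by
  simp [sameRow]

theorem sameEntry_nonneg (A B : Fin n × Fin m) : 0 ≤ sameEntry A B := by
  unfold sameEntry; split_ifs <;> norm_num

theorem sameRow_nonneg (A B : Fin n × Fin m) : 0 ≤ sameRow A B := by
  unfold sameRow; split_ifs <;> norm_num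

theorem hasLineDerivAt_exp_entry (β : ℝ) (x : Fin n → Fin m → ℝ) (i : Fin n) (j : Fin m)
    (C : Fin n × Fin m) :
    HasLineDerivAt ℝ (fun y : Fin n → Fin m → ℝ => exp (β * y i j))
      (β * (exp (β * x i j) * sameEntry (i, j) C)) x (basisMatrix C) := by
  have h : HasDerivAt (fun t : ℝ => x i j + t * sameEntry (i, j) C)
      (sameEntry (i, j) C) 0 := by
    simpa using ((hasDerivAt_id (0 : ℝ)).mul_const (sameEntry (i, j) C)).const_add (x i j)
  have h2 := (h.const_mul β).exp
  simp only [HasLineDerivAt, Pi.add_apply, Pi.smul_apply, smul_eq_mul, basisMatrix_apply]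
  refine HasDerivAt.congr_deriv h2 ?_
  simp
  ring

variable [NeZero m]

theorem expRowSum_pos (β : ℝ) (x : Fin n → Fin m → ℝ) (i : Fin n) : 0 < expRowSum β x i :=
  Finset.sum_pos (fun _ _ => exp_pos _) Finset.univ_nonempty

theorem rowWeight_nonneg (β : ℝ) (x : Fin n → Fin m → ℝ) (A : Fin n × Fin m) :
    0 ≤ rowWeight β x A :=
  div_nonneg (exp_pos _).le (expRowSum_pos _ _ _).le

theorem sum_rowWeight (β : ℝ) (x : Fin n → Fin m → ℝ) (i : Fin n) :
    ∑ j, rowWeight β x (i, j) = 1 := by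
  simp only [rowWeight]
  rw [← Finset.sum_div]
  exact div_self (expRowSum_pos β x i).ne'

theorem sum_sameRow_mul_rowWeight (β : ℝ) (x : Fin n → Fin m → ℝ) (A : Fin n × Fin m) :
    ∑ B, sameRow A B * rowWeight β x B = 1 := by
  simp only [Fintype.sum_prod_type, sameRow, ite_mul, one_mul, zero_mul]
  rw [Finset.sum_comm]
  simp [sum_rowWeight]

theorem hasLineDerivAt_expRowSum (β : ℝ) (x : Fin n → Fin m → ℝ) (i : Fin n) (j : Fin m)
    (C : Fin n × Fin m) :
    HasLineDerivAt ℝ (fun y => expRowSum β y i)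
      (β * (sameRow (i, j) C * rowWeight β x C * expRowSum β x i)) x (basisMatrix C) := by
  have h : HasLineDerivAt ℝ (fun y => expRowSum β y i)
      (∑ l, β * (exp (β * x i l) * sameEntry (i, l) C)) x (basisMatrix C) :=
    HasDerivAt.fun_sum fun l _ => hasLineDerivAt_exp_entry β x i l C
  refine HasDerivAt.congr_deriv h ?_
  rw [← Finset.mul_sum, sum_mul_sameEntry _ _ _ j]
  obtain ⟨k, l⟩ := C
  have := (expRowSum_pos β x k).ne'
  by_cases hi : i = k
  · subst hi
    simp only [sameRow, rowWeight]
    field_simp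
  · simp [sameRow, hi]

theorem hasLineDerivAt_rowWeight (β : ℝ) (x : Fin n → Fin m → ℝ) (B C : Fin n × Fin m) :
    HasLineDerivAt ℝ (fun y => rowWeight β y B)
      (β * rowWeight β x B * (sameEntry B C - sameRow B C * rowWeight β x C))
      x (basisMatrix C) := by
  have h := HasDerivAt.fun_div (hasLineDerivAt_exp_entry β x B.1 B.2 C)
    (hasLineDerivAt_expRowSum β x B.1 B.2 C)
    (by simpa using (expRowSum_pos β x B.1).ne')
  refine HasDerivAt.congr_deriv h ?_
  have := (expRowSum_pos β x B.1).ne'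
  simp only [zero_smul, add_zero]
  conv_rhs => rw [rowWeight]
  field_simp

theorem hasLineDerivAt_expRowSum_rpow (β δ : ℝ) (x : Fin n → Fin m → ℝ) (i : Fin n)
    (j : Fin m) (C : Fin n × Fin m) :
    HasLineDerivAt ℝ (fun y => expRowSum β y i ^ (-δ))
      (-δ * β * rowWeight β x C * (expRowSum β x i ^ (-δ) * sameRow (i, j) C))
      x (basisMatrix C) := by
  have hZ := expRowSum_pos β x i
  have h := HasDerivAt.rpow_const (p := -δ) (hasLineDerivAt_expRowSum β x i j C)
    (Or.inl (by simpa using hZ.ne'))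
  refine HasDerivAt.congr_deriv h ?_
  simp only [zero_smul, add_zero]
  rw [rpow_sub_one hZ.ne']
  field_simp

theorem hasLineDerivAt_partitionSum (β δ : ℝ) (x : Fin n → Fin m → ℝ) (C : Fin n × Fin m) :
    HasLineDerivAt ℝ (partitionSum β δ)
      (-δ * β * (rowWeight β x C * expRowSum β x C.1 ^ (-δ))) x (basisMatrix C) := by
  have h : HasLineDerivAt ℝ (partitionSum β δ)
      (∑ i, -δ * β * rowWeight β x C * (expRowSum β x i ^ (-δ) * sameRow (i, C.2) C))
      x (basisMatrix C) :=
    HasDerivAt.fun_sum fun i _ => hasLineDerivAt_expRowSum_rpow β δ x i C.2 C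
  refine HasDerivAt.congr_deriv h ?_
  rw [← Finset.mul_sum, sum_mul_sameRow]
  ring

variable [NeZero n]

theorem partitionSum_pos (β δ : ℝ) (x : Fin n → Fin m → ℝ) : 0 < partitionSum β δ x :=
  Finset.sum_pos (fun _ _ => rpow_pos_of_pos (expRowSum_pos _ _ _) _) Finset.univ_nonempty

theorem entryWeight_nonneg (β δ : ℝ) (x : Fin n → Fin m → ℝ) (A : Fin n × Fin m) :
    0 ≤ entryWeight β δ x A :=
  mul_nonneg (div_nonneg (rpow_nonneg (expRowSum_pos _ _ _).le _) (partitionSum_pos _ _ _).le)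
    (rowWeight_nonneg _ _ _)

theorem sum_entryWeight (β δ : ℝ) (x : Fin n → Fin m → ℝ) : ∑ A, entryWeight β δ x A = 1 := by
  simp only [entryWeight, Fintype.sum_prod_type, ← Finset.mul_sum, sum_rowWeight, mul_one]
  rw [← Finset.sum_div]
  exact div_self (partitionSum_pos β δ x).ne'

theorem contDiff_Fbd (β δ : ℝ) : ContDiff ℝ 3 (Fbd β δ : (Fin n → Fin m → ℝ) → ℝ) := by
  have h : ∀ i j, ContDiff ℝ 3 (fun y : Fin n → Fin m → ℝ => y i j) := fun i j => by fun_prop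
  refine contDiff_const.mul (ContDiff.log (ContDiff.sum fun i _ => ?_)
    fun y => (partitionSum_pos β δ y).ne')
  exact ContDiff.rpow_const_of_ne (ContDiff.sum fun j _ => (contDiff_const.mul (h i j)).exp)
    fun y => (expRowSum_pos β y i).ne'

theorem hasLineDerivAt_Fbd {β δ : ℝ} (hβ : 0 < β) (hδ : 0 < δ) (x : Fin n → Fin m → ℝ)
    (C : Fin n × Fin m) :
    HasLineDerivAt ℝ (Fbd β δ) (entryWeight β δ x C) x (basisMatrix C) := by
  have hS := partitionSum_pos β δ x
  have h := (HasDerivAt.log (hasLineDerivAt_partitionSum β δ x C)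
    (by simpa using hS.ne')).const_mul (-(1 / (β * δ)))
  have h2 : HasLineDerivAt ℝ (Fbd β δ) _ x (basisMatrix C) := h
  refine HasDerivAt.congr_deriv h2 ?_
  simp only [zero_smul, add_zero, entryWeight]
  field_simp

/-- The second partial derivative of `Fbd` at the entries `A` and `B`. -/
noncomputable def hessianEntry (β δ : ℝ) (x : Fin n → Fin m → ℝ) (A B : Fin n × Fin m) : ℝ :=
  entryWeight β δ x A * (δ * β * entryWeight β δ x B + β * sameEntry A B
    - β * (1 + δ) * (sameRow A B * rowWeight β x B))

theorem hasLineDerivAt_entryWeight (β δ : ℝ) (x : Fin n → Fin m → ℝ) (A B : Fin n × Fin m) :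
    HasLineDerivAt ℝ (fun y => entryWeight β δ y A) (hessianEntry β δ x A B)
      x (basisMatrix B) := by
  have hS := (partitionSum_pos β δ x).ne'
  have h := HasDerivAt.fun_mul (HasDerivAt.fun_div
    (hasLineDerivAt_expRowSum_rpow β δ x A.1 A.2 B)
    (hasLineDerivAt_partitionSum β δ x B) (by simpa using hS)) (hasLineDerivAt_rowWeight β x A B)
  refine HasDerivAt.congr_deriv h ?_
  simp only [zero_smul, add_zero, hessianEntry, entryWeight]
  field_simp
  ring

/-- The third partial derivative of `Fbd` at the entries `A`, `B` and `C`. -/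
noncomputable def thirdDerivEntry (β δ : ℝ) (x : Fin n → Fin m → ℝ)
    (A B C : Fin n × Fin m) : ℝ :=
  hessianEntry β δ x A C * (δ * β * entryWeight β δ x B + β * sameEntry A B
      - β * (1 + δ) * (sameRow A B * rowWeight β x B))
    + entryWeight β δ x A * (δ * β * hessianEntry β δ x B C
      - β * (1 + δ) * (sameRow A B *
        (β * rowWeight β x B * (sameEntry B C - sameRow B C * rowWeight β x C))))

theorem hasLineDerivAt_hessianEntry (β δ : ℝ) (x : Fin n → Fin m → ℝ)
    (A B C : Fin n × Fin m) :
    HasLineDerivAt ℝ (fun y => hessianEntry β δ y A B) (thirdDerivEntry β δ x A B C)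
      x (basisMatrix C) := by
  have h := HasDerivAt.fun_mul (hasLineDerivAt_entryWeight β δ x A C)
    ((((hasLineDerivAt_entryWeight β δ x B C).const_mul (δ * β)).add_const
      (β * sameEntry A B)).fun_sub
      (((hasLineDerivAt_rowWeight β x B C).const_mul (sameRow A B)).const_mul (β * (1 + δ))))
  refine HasDerivAt.congr_deriv h ?_
  simp only [zero_smul, add_zero, thirdDerivEntry]

/-- The factor of the weight of `A` in the termwise bound on `hessianEntry`. -/
noncomputable def hessianBound (β δ : ℝ) (x : Fin n → Fin m → ℝ) (A B : Fin n × Fin m) : ℝ :=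
  δ * β * entryWeight β δ x B + β * sameEntry A B
    + β * (1 + δ) * (sameRow A B * rowWeight β x B)

theorem sum_hessianBound (β δ : ℝ) (x : Fin n → Fin m → ℝ) (A : Fin n × Fin m) :
    ∑ B, hessianBound β δ x A B = 2 * β * (1 + δ) := by
  simp only [hessianBound, Finset.sum_add_distrib, ← Finset.mul_sum, sum_entryWeight,
    sum_sameEntry, sum_sameRow_mul_rowWeight]
  ring

theorem abs_add_sub_le_of_nonneg {a b c : ℝ} (ha : 0 ≤ a) (hb : 0 ≤ b) (hc : 0 ≤ c) :
    |a + b - c| ≤ a + b + c :=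
  abs_le.2 ⟨by linarith, by linarith⟩

theorem abs_hessianFactor_le {β δ : ℝ} (hβ : 0 < β) (hδ : 0 < δ) (x : Fin n → Fin m → ℝ)
    (A B : Fin n × Fin m) :
    |δ * β * entryWeight β δ x B + β * sameEntry A B
      - β * (1 + δ) * (sameRow A B * rowWeight β x B)| ≤ hessianBound β δ x A B := by
  have := entryWeight_nonneg β δ x B
  have := sameEntry_nonneg A B
  have := sameRow_nonneg A B
  have := rowWeight_nonneg β x B
  exact abs_add_sub_le_of_nonneg (by positivity) (by positivity) (by positivity)

theorem abs_hessianEntry_le {β δ : ℝ} (hβ : 0 < β) (hδ : 0 < δ) (x : Fin n → Fin m → ℝ)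
    (A B : Fin n × Fin m) :
    |hessianEntry β δ x A B| ≤ entryWeight β δ x A * hessianBound β δ x A B := by
  rw [hessianEntry, abs_mul, abs_of_nonneg (entryWeight_nonneg β δ x A)]
  exact mul_le_mul_of_nonneg_left (abs_hessianFactor_le hβ hδ x A B)
    (entryWeight_nonneg β δ x A)

theorem sum_abs_hessianEntry_right_le {β δ : ℝ} (hβ : 0 < β) (hδ : 0 < δ)
    (x : Fin n → Fin m → ℝ) (A : Fin n × Fin m) :
    ∑ B, |hessianEntry β δ x A B| ≤ entryWeight β δ x A * (2 * β * (1 + δ)) := by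
  refine (Finset.sum_le_sum fun B _ => abs_hessianEntry_le hβ hδ x A B).trans_eq ?_
  rw [← Finset.mul_sum, sum_hessianBound]

theorem sum_abs_hessianEntry_le {β δ : ℝ} (hβ : 0 < β) (hδ : 0 < δ)
    (x : Fin n → Fin m → ℝ) :
    ∑ A, ∑ B, |hessianEntry β δ x A B| ≤ 2 * β * (1 + δ) := by
  refine (Finset.sum_le_sum fun A _ => sum_abs_hessianEntry_right_le hβ hδ x A).trans_eq ?_
  rw [← Finset.sum_mul, sum_entryWeight, one_mul]

theorem abs_thirdDerivEntry_le {β δ : ℝ} (hβ : 0 < β) (hδ : 0 < δ) (x : Fin n → Fin m → ℝ)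
    (A B C : Fin n × Fin m) :
    |thirdDerivEntry β δ x A B C| ≤
      |hessianEntry β δ x A C| * hessianBound β δ x A B
        + entryWeight β δ x A * (δ * β * |hessianEntry β δ x B C|
          + β * (1 + δ) * (sameRow A B *
            (β * rowWeight β x B * (sameEntry B C + sameRow B C * rowWeight β x C)))) := by
  have h1 := entryWeight_nonneg β δ x A
  have h2 := sameEntry_nonneg B C
  have h3 := sameRow_nonneg A B
  have h4 := rowWeight_nonneg β x B
  have h5 := sameRow_nonneg B C
  have h6 := rowWeight_nonneg β x C
  have h7 : |sameEntry B C - sameRow B C * rowWeight β x C| ≤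
      sameEntry B C + sameRow B C * rowWeight β x C := by
    have := mul_nonneg h5 h6
    exact abs_le.2 ⟨by linarith, by linarith⟩
  have h8 : 0 < 1 + δ := by linarith
  rw [thirdDerivEntry]
  refine (abs_add_le _ _).trans (add_le_add ?_ ?_)
  · rw [abs_mul]
    exact mul_le_mul_of_nonneg_left (abs_hessianFactor_le hβ hδ x A B) (abs_nonneg _)
  · rw [abs_mul, abs_of_nonneg h1]
    refine mul_le_mul_of_nonneg_left ((abs_sub _ _).trans (add_le_add ?_ ?_)) h1
    · rw [abs_mul, abs_of_pos (mul_pos hδ hβ)]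
    · simp only [abs_mul, abs_of_pos hβ, abs_of_pos h8, abs_of_nonneg h3, abs_of_nonneg h4]
      gcongr

theorem sum_abs_thirdDerivEntry_le {β δ : ℝ} (hβ : 0 < β) (hδ : 0 < δ)
    (x : Fin n → Fin m → ℝ) :
    ∑ A, ∑ B, ∑ C, |thirdDerivEntry β δ x A B C| ≤ 6 * β ^ 2 * (1 + δ) ^ 2 := by
  have key : ∀ A, ∑ B, ∑ C, |thirdDerivEntry β δ x A B C| ≤
      entryWeight β δ x A * (6 * β ^ 2 * (1 + δ) ^ 2) := by
    intro A
    refine (Finset.sum_le_sum fun B _ => Finset.sum_le_sum fun C _ =>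
      abs_thirdDerivEntry_le hβ hδ x A B C).trans ?_
    simp only [Finset.sum_add_distrib, ← Finset.mul_sum, ← Finset.sum_mul, sum_sameEntry,
      sum_sameRow_mul_rowWeight, sum_hessianBound]
    have h1 : ∑ B, sameRow A B * (β * rowWeight β x B * (1 + 1)) = 2 * β := by
      conv_rhs => rw [← mul_one (2 * β), ← sum_sameRow_mul_rowWeight β x A, Finset.mul_sum]
      exact Finset.sum_congr rfl fun B _ => by ring
    rw [h1]
    have hA := entryWeight_nonneg β δ x A
    calc _ ≤ entryWeight β δ x A * (2 * β * (1 + δ)) * (2 * β * (1 + δ))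
          + entryWeight β δ x A * (δ * β * (2 * β * (1 + δ)) + β * (1 + δ) * (2 * β)) := by
          gcongr
          · exact sum_abs_hessianEntry_right_le hβ hδ x A
          · exact sum_abs_hessianEntry_le hβ hδ x
      _ = _ := by ring
  refine (Finset.sum_le_sum fun A _ => key A).trans_eq ?_
  rw [← Finset.sum_mul, sum_entryWeight, one_mul]

theorem iteratedFDeriv_three_comp_Fbd {β δ : ℝ} (hβ : 0 < β) (hδ : 0 < δ) {g : ℝ → ℝ}
    (hg : ContDiff ℝ 3 g) (x : Fin n → Fin m → ℝ) (A B C : Fin n × Fin m) :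
    iteratedFDeriv ℝ 3 (fun y => g (Fbd β δ y)) x
        ![basisMatrix A, basisMatrix B, basisMatrix C] =
      deriv (deriv (deriv g)) (Fbd β δ x) *
          (entryWeight β δ x A * entryWeight β δ x B * entryWeight β δ x C)
        + deriv (deriv g) (Fbd β δ x) *
          (hessianEntry β δ x B A * entryWeight β δ x C
            + hessianEntry β δ x C A * entryWeight β δ x B
            + hessianEntry β δ x C B * entryWeight β δ x A)
        + deriv g (Fbd β δ x) * thirdDerivEntry β δ x C B A := by
  have hg1 : ContDiff ℝ 2 (deriv g) := ContDiff.deriv' (n := 2) (by norm_num; exact hg)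
  have hg2 : ContDiff ℝ 1 (deriv (deriv g)) := ContDiff.deriv' (n := 1) (by norm_num; exact hg1)
  have comp : ∀ {φ : ℝ → ℝ}, Differentiable ℝ φ → ∀ (y : Fin n → Fin m → ℝ) (D),
      HasLineDerivAt ℝ (fun z => φ (Fbd β δ z)) (deriv φ (Fbd β δ y) * entryWeight β δ y D)
        y (basisMatrix D) := by
    intro φ hφ y D
    have h := HasDerivAt.comp (0 : ℝ) (hφ _).hasDerivAt (hasLineDerivAt_Fbd hβ hδ y D)
    simpa [HasLineDerivAt, Function.comp_def] using h
  have d0 := hg.differentiable (by norm_num)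
  have d1 := hg1.differentiable (by norm_num)
  have d2 := hg2.differentiable (by norm_num)
  refine iteratedFDeriv_three_eq_of_hasLineDerivAt (hg.comp (contDiff_Fbd β δ))
    (f₁ := fun y => deriv g (Fbd β δ y) * entryWeight β δ y C)
    (f₂ := fun y => deriv (deriv g) (Fbd β δ y) * entryWeight β δ y B * entryWeight β δ y C
      + deriv g (Fbd β δ y) * hessianEntry β δ y C B) (fun y => comp d0 y C) (fun y => ?_) ?_
  · have h := HasDerivAt.fun_mul (comp d1 y B) (hasLineDerivAt_entryWeight β δ y C B)
    simpa [HasLineDerivAt] using h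
  · have h := (HasDerivAt.fun_mul (HasDerivAt.fun_mul (comp d2 x A)
      (hasLineDerivAt_entryWeight β δ x B A)) (hasLineDerivAt_entryWeight β δ x C A)).fun_add
      (HasDerivAt.fun_mul (comp d1 x A) (hasLineDerivAt_hessianEntry β δ x C B A))
    refine HasDerivAt.congr_deriv h ?_
    simp only [zero_smul, add_zero]
    ring

theorem sum_abs_iteratedFDeriv_three_comp_Fbd_le {β δ : ℝ} (hβ : 0 < β) (hδ : 0 < δ)
    {g : ℝ → ℝ} (hg : ContDiff ℝ 3 g) (x : Fin n → Fin m → ℝ) :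
    ∑ A, ∑ B, ∑ C, |iteratedFDeriv ℝ 3 (fun y => g (Fbd β δ y)) x
        ![basisMatrix A, basisMatrix B, basisMatrix C]| ≤
      |deriv (deriv (deriv g)) (Fbd β δ x)|
        + 6 * β * (1 + δ) * |deriv (deriv g) (Fbd β δ x)|
        + 6 * β ^ 2 * (1 + δ) ^ 2 * |deriv g (Fbd β δ x)| := by
  set G₁ := |deriv g (Fbd β δ x)|
  set G₂ := |deriv (deriv g) (Fbd β δ x)|
  set G₃ := |deriv (deriv (deriv g)) (Fbd β δ x)|
  have hw := entryWeight_nonneg β δ x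
  have term : ∀ A B C, |iteratedFDeriv ℝ 3 (fun y => g (Fbd β δ y)) x
        ![basisMatrix A, basisMatrix B, basisMatrix C]| ≤
      G₃ * (entryWeight β δ x A * (entryWeight β δ x B * entryWeight β δ x C))
        + G₂ * (|hessianEntry β δ x B A| * entryWeight β δ x C
            + |hessianEntry β δ x C A| * entryWeight β δ x B
            + |hessianEntry β δ x C B| * entryWeight β δ x A)
        + G₁ * |thirdDerivEntry β δ x C B A| := by
    intro A B C
    rw [iteratedFDeriv_three_comp_Fbd hβ hδ hg]
    refine (abs_add_three _ _ _).trans ?_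
    simp only [abs_mul, abs_of_nonneg (hw _), mul_assoc]
    gcongr
    refine (abs_add_three _ _ _).trans_eq ?_
    simp only [abs_mul, abs_of_nonneg (hw _)]
  have s1 : ∑ A, ∑ B, |hessianEntry β δ x B A| ≤ 2 * β * (1 + δ) := by
    rw [Finset.sum_comm]
    exact sum_abs_hessianEntry_le hβ hδ x
  have s2 : ∑ A, ∑ B, ∑ C, |thirdDerivEntry β δ x C B A| ≤ 6 * β ^ 2 * (1 + δ) ^ 2 := by
    refine le_of_eq_of_le ?_ (sum_abs_thirdDerivEntry_le hβ hδ x)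
    calc _ = ∑ B, ∑ A, ∑ C, |thirdDerivEntry β δ x C B A| := Finset.sum_comm
      _ = ∑ B, ∑ C, ∑ A, |thirdDerivEntry β δ x C B A| :=
        Finset.sum_congr rfl fun B _ => Finset.sum_comm
      _ = _ := Finset.sum_comm
  calc _ ≤ _ := Finset.sum_le_sum fun A _ => Finset.sum_le_sum fun B _ =>
        Finset.sum_le_sum fun C _ => term A B C
    _ = G₃ + G₂ * (3 * ∑ A, ∑ B, |hessianEntry β δ x B A|)
        + G₁ * ∑ A, ∑ B, ∑ C, |thirdDerivEntry β δ x C B A| := by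
        simp only [Finset.sum_add_distrib, ← Finset.mul_sum, ← Finset.sum_mul,
          sum_entryWeight, mul_one]
        have e : ∑ A, (∑ B, ∑ C, |hessianEntry β δ x C B|) * entryWeight β δ x A
            = ∑ A, ∑ B, |hessianEntry β δ x B A| := by
          rw [← Finset.mul_sum, sum_entryWeight, mul_one]
        have e' : ∑ A, ∑ B, (∑ C, |hessianEntry β δ x C A|) * entryWeight β δ x B
            = ∑ A, ∑ B, |hessianEntry β δ x B A| := by
          simp only [← Finset.mul_sum, sum_entryWeight, mul_one]
        simp only [← Finset.mul_sum, sum_entryWeight, mul_one] at e e' ⊢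
        ring
    _ ≤ G₃ + G₂ * (3 * (2 * β * (1 + δ))) + G₁ * (6 * β ^ 2 * (1 + δ) ^ 2) := by
        gcongr
    _ = _ := by ring

end Weights

theorem stmt_9 (n m : ℕ) (β δ : ℝ) (hβ : 0 < β) (hδ : 0 < δ)
    (g : ℝ → ℝ) (hg : ContDiff ℝ 3 g)
    (hg1 : ∃ M, ∀ t, |deriv g t| ≤ M)
    (hg2 : ∃ M, ∀ t, |deriv (deriv g) t| ≤ M)
    (hg3 : ∃ M, ∀ t, |deriv (deriv (deriv g)) t| ≤ M)
    (x : Fin n → Fin m → ℝ) :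
    ∑ i₁, ∑ i₂, ∑ i₃, ∑ j₁, ∑ j₂, ∑ j₃,
        |iteratedFDeriv ℝ 3 (fun y => g (Fbd β δ y)) x
          ![Pi.single i₁ (Pi.single j₁ 1), Pi.single i₂ (Pi.single j₂ 1),
            Pi.single i₃ (Pi.single j₃ 1)]|
      ≤ (⨆ t, |deriv (deriv (deriv g)) t|) + 6 * β * (1 + δ) * (⨆ t, |deriv (deriv g) t|)
          + 6 * β ^ 2 * (1 + δ) ^ 2 * ⨆ t, |deriv g t| := by
  have h1 : 0 ≤ ⨆ t, |deriv g t| := Real.iSup_nonneg fun _ => abs_nonneg _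
  have h2 : 0 ≤ ⨆ t, |deriv (deriv g) t| := Real.iSup_nonneg fun _ => abs_nonneg _
  have h3 : 0 ≤ ⨆ t, |deriv (deriv (deriv g)) t| := Real.iSup_nonneg fun _ => abs_nonneg _
  have le_sup : ∀ {φ : ℝ → ℝ}, (∃ M, ∀ t, |φ t| ≤ M) → ∀ s, |φ s| ≤ ⨆ t, |φ t| := by
    rintro φ ⟨M, hM⟩ s
    exact le_ciSup (f := fun t => |φ t|) ⟨M, by rintro _ ⟨t, rfl⟩; exact hM t⟩ s
  rcases Nat.eq_zero_or_pos n with rfl | hn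
  · simp only [Finset.univ_eq_empty, Finset.sum_empty]
    positivity
  rcases Nat.eq_zero_or_pos m with rfl | hm
  · simp only [Finset.univ_eq_empty, Finset.sum_empty, Finset.sum_const_zero]
    positivity
  have : NeZero n := ⟨hn.ne'⟩
  have : NeZero m := ⟨hm.ne'⟩
  have sum_pairs : ∀ f : Fin n × Fin m → Fin n × Fin m → Fin n × Fin m → ℝ,
      ∑ i₁, ∑ i₂, ∑ i₃, ∑ j₁, ∑ j₂, ∑ j₃, f (i₁, j₁) (i₂, j₂) (i₃, j₃)
        = ∑ A, ∑ B, ∑ C, f A B C := by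
    intro f
    simp only [Fintype.sum_prod_type]
    refine Finset.sum_congr rfl fun i₁ _ => ?_
    calc _ = ∑ i₂, ∑ j₁, ∑ i₃, ∑ j₂, ∑ j₃, f (i₁, j₁) (i₂, j₂) (i₃, j₃) :=
          Finset.sum_congr rfl fun i₂ _ => Finset.sum_comm
      _ = ∑ j₁, ∑ i₂, ∑ i₃, ∑ j₂, ∑ j₃, f (i₁, j₁) (i₂, j₂) (i₃, j₃) := Finset.sum_comm
      _ = _ := Finset.sum_congr rfl fun j₁ _ => Finset.sum_congr rfl fun i₂ _ =>
          Finset.sum_comm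
  have key := sum_abs_iteratedFDeriv_three_comp_Fbd_le hβ hδ hg x
  rw [← sum_pairs] at key
  refine key.trans ?_
  gcongr
  · exact le_sup hg3 _
  · exact le_sup hg2 _
  · exact le_sup hg1 _
end

section
/- Let β > 0, δ > 0. For every x ∈ ℝ^{n×m}, Σ_{i₁,i₂,i₃=1}^{n} Σ_{j₁,j₂,j₃=1}^{m} |γ_{i₁,j₁,i₂,j₂,i₃,j₃}(x)| ≤ 6(1+δ)², where γ_{i₁,j₁,i₂,j₂,i₃,j₃}(x) = ω_{i₁,j₁,i₂,j₂}(x)( δ π_{i₃,j₃}(x) + δ_{i₁,i₃}( δ_{j₁,j₃} − (1+δ) p_{i₃,j₃}(x) ) ) + δ π_{i₁,j₁}(x) ω_{i₂,j₂,i₃,j₃}(x) − δ_{i₁,i₂} δ_{i₂,i₃} (1+δ) π_{i₁,j₁}(x) p_{i₂,j₂}(x) ( δ_{j₂,j₃} − p_{i₃,j₃}(x) ). -/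
open Real

/-- The weight `p_{i,j}(x)`. -/
noncomputable def pw (β : ℝ) {n m : ℕ} (x : Fin n → Fin m → ℝ) (i : Fin n) (j : Fin m) : ℝ :=
  Real.exp (β * x i j) / ∑ j', Real.exp (β * x i j')

/-- The weight `q_i(x)`. -/
noncomputable def qw (β δ : ℝ) {n m : ℕ} (x : Fin n → Fin m → ℝ) (i : Fin n) : ℝ :=
  (∑ j, Real.exp (β * x i j)) ^ (-δ) / ∑ i', (∑ j, Real.exp (β * x i' j)) ^ (-δ)

/-- The weight `π_{i,j}(x) = p_{i,j}(x) q_i(x)`. -/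
noncomputable def piw (β δ : ℝ) {n m : ℕ} (x : Fin n → Fin m → ℝ) (i : Fin n) (j : Fin m) : ℝ :=
  pw β x i j * qw β δ x i

/-- Kronecker delta. -/
def kron {α : Type*} [DecidableEq α] (a b : α) : ℝ := if a = b then 1 else 0

/-- The quantity `ω_{i₁,j₁,i₂,j₂}(x)`, equal to `β⁻¹` times the second partial derivative
of `F^{βδ}`. -/
noncomputable def omw (β δ : ℝ) {n m : ℕ} (x : Fin n → Fin m → ℝ)
    (i₁ : Fin n) (j₁ : Fin m) (i₂ : Fin n) (j₂ : Fin m) : ℝ :=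
  piw β δ x i₁ j₁ * (δ * piw β δ x i₂ j₂ + kron i₁ i₂ * (kron j₁ j₂ - (1 + δ) * pw β x i₂ j₂))

/-- The quantity `γ_{i₁,j₁,i₂,j₂,i₃,j₃}(x)`, equal to `β⁻²` times the third partial derivative
of `F^{βδ}`. -/
noncomputable def gaw (β δ : ℝ) {n m : ℕ} (x : Fin n → Fin m → ℝ)
    (i₁ : Fin n) (j₁ : Fin m) (i₂ : Fin n) (j₂ : Fin m) (i₃ : Fin n) (j₃ : Fin m) : ℝ :=
  omw β δ x i₁ j₁ i₂ j₂ * (δ * piw β δ x i₃ j₃ + kron i₁ i₃ * (kron j₁ j₃ - (1 + δ) * pw β x i₃ j₃))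
    + δ * piw β δ x i₁ j₁ * omw β δ x i₂ j₂ i₃ j₃
    - kron i₁ i₂ * kron i₂ i₃ * (1 + δ) * piw β δ x i₁ j₁ * pw β x i₂ j₂ *
        (kron j₂ j₃ - pw β x i₃ j₃)

lemma kron_nonneg {α : Type*} [DecidableEq α] (a b : α) : 0 ≤ kron a b := by
  unfold kron; split_ifs <;> norm_num

lemma sum_kron_mul {α : Type*} [Fintype α] [DecidableEq α] (a : α) (f : α → ℝ) :
    ∑ b, kron a b * f b = f a := by
  simp [kron]

lemma sum_kron_fst_mul {ι κ : Type*} [Fintype ι] [Fintype κ] [DecidableEq ι] (i : ι)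
    (f : ι → κ → ℝ) : ∑ b : ι × κ, kron i b.1 * f b.1 b.2 = ∑ j, f i j := by
  rw [Fintype.sum_prod_type]
  simp only [← Finset.mul_sum]
  exact sum_kron_mul i fun i' => ∑ j, f i' j

lemma pw_nonneg (β : ℝ) {n m : ℕ} (x : Fin n → Fin m → ℝ) (i : Fin n) (j : Fin m) :
    0 ≤ pw β x i j := by
  unfold pw; positivity

lemma sum_pw_le_one (β : ℝ) {n m : ℕ} (x : Fin n → Fin m → ℝ) (i : Fin n) :
    ∑ j, pw β x i j ≤ 1 := by
  unfold pw
  rw [← Finset.sum_div]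
  exact div_self_le_one _

lemma qw_nonneg (β δ : ℝ) {n m : ℕ} (x : Fin n → Fin m → ℝ) (i : Fin n) : 0 ≤ qw β δ x i := by
  unfold qw; positivity

lemma sum_qw_le_one (β δ : ℝ) {n m : ℕ} (x : Fin n → Fin m → ℝ) : ∑ i, qw β δ x i ≤ 1 := by
  unfold qw
  rw [← Finset.sum_div]
  exact div_self_le_one _

lemma piw_nonneg (β δ : ℝ) {n m : ℕ} (x : Fin n → Fin m → ℝ) (i : Fin n) (j : Fin m) :
    0 ≤ piw β δ x i j :=
  mul_nonneg (pw_nonneg β x i j) (qw_nonneg β δ x i)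

lemma sum_piw_le_one (β δ : ℝ) {n m : ℕ} (x : Fin n → Fin m → ℝ) :
    ∑ a : Fin n × Fin m, piw β δ x a.1 a.2 ≤ 1 := by
  rw [Fintype.sum_prod_type]
  simp only [piw, ← Finset.sum_mul]
  exact (Finset.sum_le_sum fun i _ =>
    mul_le_of_le_one_left (qw_nonneg β δ x i) (sum_pw_le_one β x i)).trans (sum_qw_le_one β δ x)

/-- The total mass of `δ_{j,j'} + s p_{i',j'}` over the block `i' = i` is at most `1 + s`. -/
lemma sum_kron_mul_kron_add_le (β : ℝ) {s : ℝ} (hs : 0 ≤ s) {n m : ℕ} (x : Fin n → Fin m → ℝ)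
    (i : Fin n) (j : Fin m) :
    ∑ b : Fin n × Fin m, kron i b.1 * (kron j b.2 + s * pw β x b.1 b.2) ≤ 1 + s := by
  rw [sum_kron_fst_mul i fun i' j' => kron j j' + s * pw β x i' j', Finset.sum_add_distrib,
    ← Finset.mul_sum]
  have h : ∑ j', kron j j' = 1 := by simpa using sum_kron_mul j fun _ => (1 : ℝ)
  nlinarith [sum_pw_le_one β x i]

lemma abs_kron_sub_le (β : ℝ) {s : ℝ} (hs : 0 ≤ s) {n m : ℕ} (x : Fin n → Fin m → ℝ)
    (j : Fin m) (i' : Fin n) (j' : Fin m) :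
    |kron j j' - s * pw β x i' j'| ≤ kron j j' + s * pw β x i' j' := by
  have h₁ := kron_nonneg j j'
  have h₂ := mul_nonneg hs (pw_nonneg β x i' j')
  exact abs_le.2 ⟨by linarith, by linarith⟩

lemma sum_kron_mul_abs_kron_sub_le (β : ℝ) {s : ℝ} (hs : 0 ≤ s) {n m : ℕ}
    (x : Fin n → Fin m → ℝ) (i : Fin n) (j : Fin m) :
    ∑ b : Fin n × Fin m, kron i b.1 * |kron j b.2 - s * pw β x b.1 b.2| ≤ 1 + s :=
  (Finset.sum_le_sum fun b _ => mul_le_mul_of_nonneg_left (abs_kron_sub_le β hs x j b.1 b.2)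
    (kron_nonneg i b.1)).trans (sum_kron_mul_kron_add_le β hs x i j)

/-- The logarithmic derivative factor: `ω_{a,b} = π_a * dlogPiw a b`. -/
noncomputable def dlogPiw (β δ : ℝ) {n m : ℕ} (x : Fin n → Fin m → ℝ) (a b : Fin n × Fin m) : ℝ :=
  δ * piw β δ x b.1 b.2 + kron a.1 b.1 * (kron a.2 b.2 - (1 + δ) * pw β x b.1 b.2)

lemma sum_abs_dlogPiw_le (β : ℝ) {δ : ℝ} (hδ : 0 ≤ δ) {n m : ℕ} (x : Fin n → Fin m → ℝ)
    (a : Fin n × Fin m) : ∑ b, |dlogPiw β δ x a b| ≤ 2 * (1 + δ) := by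
  calc ∑ b, |dlogPiw β δ x a b|
      ≤ ∑ b : Fin n × Fin m, (δ * piw β δ x b.1 b.2 +
          kron a.1 b.1 * |kron a.2 b.2 - (1 + δ) * pw β x b.1 b.2|) := by
        refine Finset.sum_le_sum fun b _ => (abs_add_le _ _).trans_eq ?_
        rw [abs_mul (kron _ _), abs_of_nonneg (kron_nonneg a.1 b.1),
          abs_of_nonneg (mul_nonneg hδ (piw_nonneg β δ x b.1 b.2))]
    _ ≤ 2 * (1 + δ) := by
        rw [Finset.sum_add_distrib, ← Finset.mul_sum]
        nlinarith [sum_piw_le_one β δ x,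
          sum_kron_mul_abs_kron_sub_le β (by linarith : 0 ≤ 1 + δ) x a.1 a.2]

lemma abs_gaw_le (β : ℝ) {δ : ℝ} (hδ : 0 ≤ δ) {n m : ℕ} (x : Fin n → Fin m → ℝ)
    (a b c : Fin n × Fin m) :
    |gaw β δ x a.1 a.2 b.1 b.2 c.1 c.2| ≤ piw β δ x a.1 a.2 *
      (|dlogPiw β δ x a b| * |dlogPiw β δ x a c| +
        δ * piw β δ x b.1 b.2 * |dlogPiw β δ x b c| +
        (1 + δ) * (kron a.1 b.1 * pw β x b.1 b.2) *
          (kron b.1 c.1 * |kron b.2 c.2 - 1 * pw β x c.1 c.2|)) := by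
  have ha := piw_nonneg β δ x a.1 a.2
  have h : gaw β δ x a.1 a.2 b.1 b.2 c.1 c.2 = piw β δ x a.1 a.2 *
      (dlogPiw β δ x a b * dlogPiw β δ x a c + δ * piw β δ x b.1 b.2 * dlogPiw β δ x b c -
        (1 + δ) * (kron a.1 b.1 * pw β x b.1 b.2) *
          (kron b.1 c.1 * (kron b.2 c.2 - 1 * pw β x c.1 c.2))) := by
    unfold gaw omw dlogPiw; ring
  rw [h, abs_mul, abs_of_nonneg ha]
  refine mul_le_mul_of_nonneg_left ((abs_sub _ _).trans (add_le_add ((abs_add_le _ _).trans_eq ?_)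
    (le_of_eq ?_))) ha
  · rw [abs_mul, abs_mul (δ * _), abs_of_nonneg (mul_nonneg hδ (piw_nonneg β δ x b.1 b.2))]
  · rw [abs_mul, abs_mul (kron b.1 c.1), abs_of_nonneg (kron_nonneg b.1 c.1),
      abs_of_nonneg (mul_nonneg (by linarith) (mul_nonneg (kron_nonneg a.1 b.1)
        (pw_nonneg β x b.1 b.2)))]

lemma sum_prod_abs_gaw_le (β : ℝ) {δ : ℝ} (hδ : 0 ≤ δ) {n m : ℕ} (x : Fin n → Fin m → ℝ) :
    ∑ a : Fin n × Fin m, ∑ b : Fin n × Fin m, ∑ c : Fin n × Fin m,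
      |gaw β δ x a.1 a.2 b.1 b.2 c.1 c.2| ≤ 6 * (1 + δ) ^ 2 := by
  have hδ' : 0 ≤ 1 + δ := by linarith
  have hc (a b : Fin n × Fin m) :
      ∑ c : Fin n × Fin m, |gaw β δ x a.1 a.2 b.1 b.2 c.1 c.2| ≤ piw β δ x a.1 a.2 *
        (|dlogPiw β δ x a b| * (2 * (1 + δ)) + δ * piw β δ x b.1 b.2 * (2 * (1 + δ)) +
          (1 + δ) * (kron a.1 b.1 * pw β x b.1 b.2) * (1 + 1)) := by
    refine (Finset.sum_le_sum fun c _ => abs_gaw_le β hδ x a b c).trans ?_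
    rw [← Finset.mul_sum, Finset.sum_add_distrib, Finset.sum_add_distrib, ← Finset.mul_sum,
      ← Finset.mul_sum, ← Finset.mul_sum]
    have hb := piw_nonneg β δ x b.1 b.2
    have hk := mul_nonneg (kron_nonneg a.1 b.1) (pw_nonneg β x b.1 b.2)
    have ha := piw_nonneg β δ x a.1 a.2
    gcongr
    · exact sum_abs_dlogPiw_le β hδ x a
    · exact sum_abs_dlogPiw_le β hδ x b
    · exact sum_kron_mul_abs_kron_sub_le β zero_le_one x b.1 b.2
  have hb (a : Fin n × Fin m) :
      ∑ b : Fin n × Fin m, ∑ c : Fin n × Fin m, |gaw β δ x a.1 a.2 b.1 b.2 c.1 c.2| ≤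
        piw β δ x a.1 a.2 * (6 * (1 + δ) ^ 2) := by
    refine (Finset.sum_le_sum fun b _ => hc a b).trans ?_
    rw [← Finset.mul_sum, Finset.sum_add_distrib, Finset.sum_add_distrib, ← Finset.sum_mul,
      ← Finset.sum_mul, ← Finset.sum_mul, ← Finset.mul_sum, ← Finset.mul_sum,
      sum_kron_fst_mul a.1 fun i j => pw β x i j]
    refine mul_le_mul_of_nonneg_left ?_ (piw_nonneg β δ x a.1 a.2)
    calc _ ≤ 2 * (1 + δ) * (2 * (1 + δ)) + δ * 1 * (2 * (1 + δ)) + (1 + δ) * 1 * (1 + 1) := by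
          gcongr
          · exact sum_abs_dlogPiw_le β hδ x a
          · exact sum_piw_le_one β δ x
          · exact sum_pw_le_one β x a.1
      _ = 6 * (1 + δ) ^ 2 := by ring
  refine (Finset.sum_le_sum fun a _ => hb a).trans ?_
  rw [← Finset.sum_mul]
  exact mul_le_of_le_one_left (by positivity) (sum_piw_le_one β δ x)

theorem stmt_13 (n m : ℕ) (β δ : ℝ) (hβ : 0 < β) (hδ : 0 < δ)
    (x : Fin n → Fin m → ℝ) :
    ∑ i₁, ∑ i₂, ∑ i₃, ∑ j₁, ∑ j₂, ∑ j₃, |gaw β δ x i₁ j₁ i₂ j₂ i₃ j₃| ≤ 6 * (1 + δ) ^ 2 := by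
  refine le_of_eq_of_le ?_ (sum_prod_abs_gaw_le β hδ.le x)
  simp only [Fintype.sum_prod_type]
  refine Finset.sum_congr rfl fun i₁ _ => ?_
  calc _ = ∑ i₂, ∑ j₁, ∑ i₃, ∑ j₂, ∑ j₃, |gaw β δ x i₁ j₁ i₂ j₂ i₃ j₃| :=
        Finset.sum_congr rfl fun i₂ _ => Finset.sum_comm
    _ = ∑ j₁, ∑ i₂, ∑ i₃, ∑ j₂, ∑ j₃, |gaw β δ x i₁ j₁ i₂ j₂ i₃ j₃| := Finset.sum_comm
    _ = _ := Finset.sum_congr rfl fun j₁ _ => Finset.sum_congr rfl fun i₂ _ => Finset.sum_comm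
end
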